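/- Let V ⊆ ℂ be a nonempty connected open set, ρ a holomorphic function on V, and let u, v be smooth real-valued functions on V each satisfying the system 4 ∂_z ∂_z̄ u = e^(−2u) and ∂²_zz u + (∂_z u)² = −ρ/4. If u(z₀) = v(z₀) and ∂_z u(z₀) = ∂_z v(z₀) for some point z₀ ∈ V, then u = v on all of V. (A solution of the system is uniquely determined by prescribing its value and its ∂_z-derivative at one point.) -/

import Mathlib

/-- The Wirtinger derivative `∂_z f = (1/2)(∂_x f - i ∂_y f)`. -/
noncomputable def wirtingerZ (f : ℂ → ℂ) (z : ℂ) : ℂ :=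
  (1 / 2) * (fderiv ℝ f z 1 - Complex.I * fderiv ℝ f z Complex.I)

/-- The conjugate Wirtinger derivative `∂_z̄ f = (1/2)(∂_x f + i ∂_y f)`. -/
noncomputable def wirtingerZbar (f : ℂ → ℂ) (z : ℂ) : ℂ :=
  (1 / 2) * (fderiv ℝ f z 1 + Complex.I * fderiv ℝ f z Complex.I)

open Filter Topology in
/-- A differentiable function on a preconnected open set whose derivative is, near each of its
zeros, bounded by a multiple of the function itself vanishes as soon as it has one zero. -/
theorem eqOn_zero_of_norm_fderiv_le {E F : Type*} [NormedAddCommGroup E] [NormedSpace ℝ E]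
    [NormedAddCommGroup F] [NormedSpace ℝ F] {V : Set E} (hV : IsOpen V)
    (hVconn : IsPreconnected V) {D : E → F} (hD : DifferentiableOn ℝ D V)
    (hbound : ∀ z ∈ V, D z = 0 → ∃ K : ℝ, ∀ᶠ w in 𝓝 z, ‖fderiv ℝ D w‖ ≤ K * ‖D w‖)
    {z₀ : E} (hz₀ : z₀ ∈ V) (h₀ : D z₀ = 0) : ∀ z ∈ V, D z = 0 := by
  have hdiff : ∀ z ∈ V, DifferentiableAt ℝ D z := fun z hz =>
    (hD z hz).differentiableAt (hV.mem_nhds hz)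
  have hopen : IsOpen {z | z ∈ V ∧ D z = 0} := by
    rw [isOpen_iff_mem_nhds]
    rintro z ⟨hz, hDz⟩
    obtain ⟨K, hK⟩ := hbound z hz hDz
    obtain ⟨r, hr, hball⟩ := Metric.eventually_nhds_iff_ball.1 (hK.and (hV.mem_nhds hz))
    refine mem_of_superset (Metric.ball_mem_nhds z hr) fun w hw => ⟨(hball w hw).2, ?_⟩
    have hmem : ∀ t ∈ Set.Icc (0 : ℝ) 1, z + t • (w - z) ∈ Metric.ball z r := fun t ht =>
      (convex_ball z r).add_smul_sub_mem (Metric.mem_ball_self hr) hw ht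
    have hder : ∀ t ∈ Set.Icc (0 : ℝ) 1, HasDerivAt (fun s : ℝ => D (z + s • (w - z)))
        (fderiv ℝ D (z + t • (w - z)) (w - z)) t := by
      intro t ht
      have hline : HasDerivAt (fun s : ℝ => z + s • (w - z)) (w - z) t := by
        simpa using ((hasDerivAt_id t).smul_const (w - z)).const_add z
      exact (hdiff _ (hball _ (hmem t ht)).2).hasFDerivAt.comp_hasDerivAt t hline
    have hzero := eq_zero_of_abs_deriv_le_mul_abs_self_of_eq_zero_right
      (K := K * ‖w - z‖)
      (fun t ht => (hder t ht).continuousAt.continuousWithinAt)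
      (fun t ht => (hder t (Set.Ico_subset_Icc_self ht)).hasDerivWithinAt) (by simpa using hDz)
      (fun t ht => by
        have h := (hball _ (hmem t (Set.Ico_subset_Icc_self ht))).1
        calc _ ≤ ‖fderiv ℝ D (z + t • (w - z))‖ * ‖w - z‖ := ContinuousLinearMap.le_opNorm _ _
          _ ≤ K * ‖D (z + t • (w - z))‖ * ‖w - z‖ := by gcongr
          _ = _ := by ring)
    simpa using hzero 1 (by simp)
  have hsub : V ⊆ {z | z ∈ V ∧ D z = 0} := by
    refine hVconn.subset_of_closure_inter_subset hopen ⟨z₀, hz₀, hz₀, h₀⟩ ?_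
    rintro z ⟨hzc, hz⟩
    refine ⟨hz, ?_⟩
    have h := (hdiff z hz).continuousAt.continuousWithinAt.mem_closure (t := {0}) hzc
      fun y hy => hy.2
    simpa using h
  exact fun z hz => (hsub hz).2

theorem fderiv_eq_wirtinger (f : ℂ → ℂ) (z h : ℂ) :
    fderiv ℝ f z h = wirtingerZ f z * h + wirtingerZbar f z * starRingEnd ℂ h := by
  have hh : h = h.re • (1 : ℂ) + h.im • Complex.I := by
    simp [Complex.re_add_im]
  conv_lhs => rw [hh, map_add, map_smul, map_smul]
  conv_rhs => rw [hh]
  simp only [wirtingerZ, wirtingerZbar, Complex.real_smul, map_add, map_mul, Complex.conj_ofReal,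
    Complex.conj_I, map_one]
  linear_combination (h.im * fderiv ℝ f z Complex.I) * Complex.I_sq

theorem wirtingerZbar_ofReal {u : ℂ → ℝ} {z : ℂ} (hu : DifferentiableAt ℝ u z) :
    wirtingerZbar (fun w => (u w : ℂ)) z
      = starRingEnd ℂ (wirtingerZ (fun w => (u w : ℂ)) z) := by
  have h : fderiv ℝ (fun w => (u w : ℂ)) z = Complex.ofRealCLM.comp (fderiv ℝ u z) :=
    (Complex.ofRealCLM.hasFDerivAt.comp z hu.hasFDerivAt).fderiv
  simp [wirtingerZ, wirtingerZbar, h, map_ofNat]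

theorem hasFDerivAt_fderiv_apply {f : ℂ → ℂ} {z : ℂ} (hf : ContDiffAt ℝ 2 f z) (h : ℂ) :
    HasFDerivAt (fun w => fderiv ℝ f w h) ((fderiv ℝ (fderiv ℝ f) z).flip h) z := by
  have h1 : DifferentiableAt ℝ (fderiv ℝ f) z :=
    (hf.fderiv_right (m := 1) (by norm_num)).differentiableAt (by norm_num)
  exact ((ContinuousLinearMap.apply ℝ ℂ h).hasFDerivAt.comp z h1.hasFDerivAt)

theorem hasFDerivAt_wirtingerZ {f : ℂ → ℂ} {z : ℂ} (hf : ContDiffAt ℝ 2 f z) :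
    HasFDerivAt (wirtingerZ f) ((1 / 2 : ℂ) • ((fderiv ℝ (fderiv ℝ f) z).flip 1
      - Complex.I • (fderiv ℝ (fderiv ℝ f) z).flip Complex.I)) z :=
  ((hasFDerivAt_fderiv_apply hf 1).sub
    ((hasFDerivAt_fderiv_apply hf Complex.I).const_mul Complex.I)).const_mul (1 / 2)

theorem hasFDerivAt_wirtingerZbar {f : ℂ → ℂ} {z : ℂ} (hf : ContDiffAt ℝ 2 f z) :
    HasFDerivAt (wirtingerZbar f) ((1 / 2 : ℂ) • ((fderiv ℝ (fderiv ℝ f) z).flip 1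
      + Complex.I • (fderiv ℝ (fderiv ℝ f) z).flip Complex.I)) z :=
  ((hasFDerivAt_fderiv_apply hf 1).add
    ((hasFDerivAt_fderiv_apply hf Complex.I).const_mul Complex.I)).const_mul (1 / 2)

theorem wirtingerZbar_wirtingerZ_comm {f : ℂ → ℂ} {z : ℂ} (hf : ContDiffAt ℝ 2 f z) :
    wirtingerZbar (wirtingerZ f) z = wirtingerZ (wirtingerZbar f) z := by
  have hsymm : IsSymmSndFDerivAt ℝ f z := hf.isSymmSndFDerivAt (by simp)
  have h := hsymm.eq 1 Complex.I
  rw [wirtingerZbar, wirtingerZ, (hasFDerivAt_wirtingerZ hf).fderiv,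
    (hasFDerivAt_wirtingerZbar hf).fderiv]
  simp only [smul_apply, sub_apply,
    add_apply, ContinuousLinearMap.flip_apply, smul_eq_mul, h]
  ring

theorem contDiffAt_ofReal_comp {V : Set ℂ} (hV : IsOpen V) {u : ℂ → ℝ}
    (hu : ContDiffOn ℝ (⊤ : ℕ∞) u V) {z : ℂ} (hz : z ∈ V) :
    ContDiffAt ℝ 2 (fun w => (u w : ℂ)) z :=
  Complex.ofRealCLM.contDiff.contDiffAt.comp z
    (((hu z hz).contDiffAt (hV.mem_nhds hz)).of_le (WithTop.coe_le_coe.2 le_top))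

/-- The derivative of `∂_z u` along a solution, expressed through `u` and `∂_z u` alone. -/
theorem fderiv_wirtingerZ_of_system {ρ f : ℂ → ℂ} {z : ℂ} (hf : ContDiffAt ℝ 2 f z)
    (hLiou : 4 * wirtingerZ (wirtingerZbar f) z = Complex.exp (-2 * f z))
    (hEnt : wirtingerZ (wirtingerZ f) z + wirtingerZ f z ^ 2 = -ρ z / 4) (h : ℂ) :
    fderiv ℝ (wirtingerZ f) z h
      = (-ρ z / 4 - wirtingerZ f z ^ 2) * h
        + Complex.exp (-2 * f z) / 4 * starRingEnd ℂ h := by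
  rw [fderiv_eq_wirtinger, wirtingerZbar_wirtingerZ_comm hf, ← hEnt, ← hLiou]
  ring

/-- A smooth real-valued solution of the system `4 ∂_z ∂_z̄ u = e^(-2u)`,
`∂²_zz u + (∂_z u)² = -ρ/4` on a nonempty connected open set `V ⊆ ℂ` is uniquely
determined by its value and its `∂_z`-derivative at a single point `z₀ ∈ V`. -/
theorem system_solution_unique_from_initial_data
    (V : Set ℂ) (hV : IsOpen V) (hVconn : IsConnected V)
    (ρ : ℂ → ℂ) (hρ : DifferentiableOn ℂ ρ V)
    (u v : ℂ → ℝ) (hu : ContDiffOn ℝ (⊤ : ℕ∞) u V) (hv : ContDiffOn ℝ (⊤ : ℕ∞) v V)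
    (hLiouU : ∀ z ∈ V,
      4 * wirtingerZ (wirtingerZbar (fun w => (u w : ℂ))) z
        = Complex.exp (-2 * (u z : ℂ)))
    (hEntU : ∀ z ∈ V,
      wirtingerZ (wirtingerZ (fun w => (u w : ℂ))) z
        + (wirtingerZ (fun w => (u w : ℂ)) z) ^ 2 = -ρ z / 4)
    (hLiouV : ∀ z ∈ V,
      4 * wirtingerZ (wirtingerZbar (fun w => (v w : ℂ))) z
        = Complex.exp (-2 * (v z : ℂ)))
    (hEntV : ∀ z ∈ V,
      wirtingerZ (wirtingerZ (fun w => (v w : ℂ))) z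
        + (wirtingerZ (fun w => (v w : ℂ)) z) ^ 2 = -ρ z / 4)
    (z₀ : ℂ) (hz₀ : z₀ ∈ V)
    (hval : u z₀ = v z₀)
    (hderiv : wirtingerZ (fun w => (u w : ℂ)) z₀
      = wirtingerZ (fun w => (v w : ℂ)) z₀) :
    Set.EqOn u v V := by
  set f : ℂ → ℂ := fun w => (u w : ℂ)
  set g : ℂ → ℂ := fun w => (v w : ℂ)
  have hf2 : ∀ z ∈ V, ContDiffAt ℝ 2 f z := fun z hz => contDiffAt_ofReal_comp hV hu hz
  have hg2 : ∀ z ∈ V, ContDiffAt ℝ 2 g z := fun z hz => contDiffAt_ofReal_comp hV hv hz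
  have hdf : ∀ z ∈ V, DifferentiableAt ℝ f z := fun z hz => (hf2 z hz).differentiableAt (by simp)
  have hdg : ∀ z ∈ V, DifferentiableAt ℝ g z := fun z hz => (hg2 z hz).differentiableAt (by simp)
  have hdp : ∀ z ∈ V, DifferentiableAt ℝ (wirtingerZ f) z := fun z hz =>
    (hasFDerivAt_wirtingerZ (hf2 z hz)).differentiableAt
  have hdq : ∀ z ∈ V, DifferentiableAt ℝ (wirtingerZ g) z := fun z hz =>
    (hasFDerivAt_wirtingerZ (hg2 z hz)).differentiableAt
  have hdu : ∀ z ∈ V, DifferentiableAt ℝ u z := fun z hz =>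
    ((hu z hz).contDiffAt (hV.mem_nhds hz)).differentiableAt (by simp)
  have hdv : ∀ z ∈ V, DifferentiableAt ℝ v z := fun z hz =>
    ((hv z hz).contDiffAt (hV.mem_nhds hz)).differentiableAt (by simp)
  have hconjf : ∀ z ∈ V, wirtingerZbar f z = starRingEnd ℂ (wirtingerZ f z) := fun z hz =>
    wirtingerZbar_ofReal (hdu z hz)
  have hconjg : ∀ z ∈ V, wirtingerZbar g z = starRingEnd ℂ (wirtingerZ g z) := fun z hz =>
    wirtingerZbar_ofReal (hdv z hz)
  let D : ℂ → ℂ × ℂ := fun w => (f w - g w, wirtingerZ f w - wirtingerZ g w)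
  have hD : ∀ z ∈ V, HasFDerivAt D ((fderiv ℝ f z - fderiv ℝ g z).prod
      (fderiv ℝ (wirtingerZ f) z - fderiv ℝ (wirtingerZ g) z)) z := fun z hz =>
    ((hdf z hz).hasFDerivAt.sub (hdg z hz).hasFDerivAt).prodMk
      ((hdp z hz).hasFDerivAt.sub (hdq z hz).hasFDerivAt)
  have hzero : ∀ z ∈ V, D z = 0 := by
    refine eqOn_zero_of_norm_fderiv_le hV hVconn.isPreconnected
      (fun z hz => (hD z hz).differentiableAt.differentiableWithinAt) ?_ hz₀
      (Prod.ext (by simp [D, f, g, hval]) (sub_eq_zero.2 hderiv))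
    intro z hz hDz
    obtain ⟨hfg, hpq⟩ : f z = g z ∧ wirtingerZ f z = wirtingerZ g z := by
      simpa [D, Prod.ext_iff, sub_eq_zero] using hDz
    have hsmooth : ContDiff ℝ 1 fun x : ℂ × ℂ => (x.2 ^ 2, Complex.exp (-2 * x.1)) := by
      fun_prop
    obtain ⟨K, t, ht, hK⟩ := hsmooth.contDiffAt.exists_lipschitzOnWith (x := (f z, wirtingerZ f z))
    have htf : ∀ᶠ w in nhds z, (f w, wirtingerZ f w) ∈ t :=
      ((hdf z hz).continuousAt.prodMk (hdp z hz).continuousAt).eventually ht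
    have htg : ∀ᶠ w in nhds z, (g w, wirtingerZ g w) ∈ t :=
      ((hdg z hz).continuousAt.prodMk (hdq z hz).continuousAt).eventually_mem
        (by simpa only [hfg, hpq] using ht)
    refine ⟨2 + 2 * K, ?_⟩
    filter_upwards [htf, htg, hV.mem_nhds hz] with w hwf hwg hw
    have hlip := hK.norm_sub_le hwf hwg
    have hlip1 : ‖wirtingerZ f w ^ 2 - wirtingerZ g w ^ 2‖ ≤ K * ‖D w‖ :=
      (norm_fst_le _).trans hlip
    have hlip2 : ‖Complex.exp (-2 * f w) - Complex.exp (-2 * g w)‖ ≤ K * ‖D w‖ :=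
      (norm_snd_le _).trans hlip
    have hq : ‖wirtingerZ f w - wirtingerZ g w‖ ≤ ‖D w‖ := norm_snd_le (D w)
    have hK0 : 0 ≤ K * ‖D w‖ := by positivity
    rw [(hD w hw).fderiv]
    refine ContinuousLinearMap.opNorm_le_bound _ (by positivity) fun h => ?_
    rw [ContinuousLinearMap.prod_apply, Prod.norm_def]
    refine max_le ?_ ?_
    · dsimp only
      rw [sub_apply, fderiv_eq_wirtinger, fderiv_eq_wirtinger,
        hconjf w hw, hconjg w hw]
      calc _ = ‖(wirtingerZ f w - wirtingerZ g w) * h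
            + starRingEnd ℂ (wirtingerZ f w - wirtingerZ g w) * starRingEnd ℂ h‖ := by
            rw [map_sub]; ring_nf
        _ ≤ ‖wirtingerZ f w - wirtingerZ g w‖ * ‖h‖
            + ‖wirtingerZ f w - wirtingerZ g w‖ * ‖h‖ := by
            refine (norm_add_le _ _).trans_eq ?_
            simp only [norm_mul, RCLike.norm_conj]
        _ ≤ ‖D w‖ * ‖h‖ + ‖D w‖ * ‖h‖ := by gcongr
        _ ≤ (2 + 2 * K) * ‖D w‖ * ‖h‖ := by nlinarith [mul_nonneg hK0 (norm_nonneg h)]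
    · dsimp only
      rw [sub_apply,
        fderiv_wirtingerZ_of_system (hf2 w hw) (hLiouU w hw) (hEntU w hw),
        fderiv_wirtingerZ_of_system (hg2 w hw) (hLiouV w hw) (hEntV w hw)]
      calc _ = ‖-(wirtingerZ f w ^ 2 - wirtingerZ g w ^ 2) * h
            + (Complex.exp (-2 * f w) - Complex.exp (-2 * g w)) / 4 * starRingEnd ℂ h‖ := by
            ring_nf
        _ ≤ ‖wirtingerZ f w ^ 2 - wirtingerZ g w ^ 2‖ * ‖h‖
            + ‖Complex.exp (-2 * f w) - Complex.exp (-2 * g w)‖ / 4 * ‖h‖ := by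
            refine (norm_add_le _ _).trans_eq ?_
            simp only [norm_mul, norm_neg, norm_div, RCLike.norm_conj, RCLike.norm_ofNat]
        _ ≤ K * ‖D w‖ * ‖h‖ + K * ‖D w‖ / 4 * ‖h‖ := by gcongr
        _ ≤ (2 + 2 * K) * ‖D w‖ * ‖h‖ := by
            nlinarith [mul_nonneg hK0 (norm_nonneg h), mul_nonneg (norm_nonneg (D w)) (norm_nonneg h)]
  intro z hz
  have h : f z - g z = 0 := congrArg Prod.fst (hzero z hz)
  exact Complex.ofReal_injective (sub_eq_zero.1 h)
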